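/- arXiv:1810.04459 — 3 statements merged into one kernel-verified Lean document; each statement's English description precedes it below -/
import Mathlib

section
/- For any finite-dimensional Lie superalgebra L over a field F (char F ≠ 2,3), the epicenter equals the exterior center: Z*(L) = Z∧(L). -/
/-!
Common definitions: Lie superalgebras over a field `F` (char ≠ 2,3 where needed),
graded ideals, centers, capability, epicenter, non-abelian tensor and exterior
products (characterized by generators-and-relations universal properties),
free Lie superalgebras, Schur multipliers, Heisenberg Lie superalgebras, etc.
-/

namespace SuperLie

open Submodule Function Module

universe u v w

/-- The sign `(-1)^{|a||b|}` attached to a pair of `ℤ₂`-degrees. -/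
def sg (F : Type u) [Field F] (a b : ZMod 2) : F := (-1 : F) ^ (a.val * b.val)

/-- A Lie superalgebra over `F`: a `ℤ₂`-graded vector space `L = L₀ ⊕ L₁`
together with an even bilinear bracket satisfying graded skew-symmetry and the
graded Jacobi identity (on homogeneous elements). -/
class LieSuper (F : Type u) [Field F] (L : Type v) [AddCommGroup L] [Module F L] where
  gr : ZMod 2 → Submodule F L
  isCompl_gr : IsCompl (gr 0) (gr 1)
  br : L → L → L
  br_add_left : ∀ x y z : L, br (x + y) z = br x z + br y z
  br_add_right : ∀ x y z : L, br x (y + z) = br x y + br x z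
  br_smul_left : ∀ (c : F) (x y : L), br (c • x) y = c • br x y
  br_smul_right : ∀ (c : F) (x y : L), br x (c • y) = c • br x y
  br_gr : ∀ a b : ZMod 2, ∀ x ∈ gr a, ∀ y ∈ gr b, br x y ∈ gr (a + b)
  br_skew : ∀ a b : ZMod 2, ∀ x ∈ gr a, ∀ y ∈ gr b, br x y = -(sg F a b) • br y x
  br_jacobi : ∀ a b c : ZMod 2, ∀ x ∈ gr a, ∀ y ∈ gr b, ∀ z ∈ gr c,
    sg F a c • br x (br y z) + sg F b a • br y (br z x) + sg F c b • br z (br x y) = 0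

/-- The `a`-graded piece of a Lie superalgebra. -/
def grd (F : Type u) [Field F] (L : Type v) [AddCommGroup L] [Module F L] [LieSuper F L]
    (a : ZMod 2) : Submodule F L :=
  LieSuper.gr a

/-- The bracket of a Lie superalgebra. -/
def sbr (F : Type u) [Field F] {L : Type v} [AddCommGroup L] [Module F L] [LieSuper F L]
    (x y : L) : L :=
  LieSuper.br (F := F) x y

/-- The center `Z(L) = {z ∈ L : [z,x] = 0 for all x ∈ L}`. -/
def centerS (F : Type u) [Field F] (L : Type v) [AddCommGroup L] [Module F L] [LieSuper F L] :
    Submodule F L where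
  carrier := {z : L | ∀ x : L, sbr F z x = 0}
  add_mem' := by
    intro a b ha hb x
    simp only [Set.mem_setOf_eq, sbr] at ha hb ⊢
    rw [LieSuper.br_add_left, ha x, hb x, add_zero]
  zero_mem' := by
    intro x
    have h := LieSuper.br_smul_left (F := F) (0 : F) (0 : L) x
    simp only [Set.mem_setOf_eq, sbr, zero_smul] at h ⊢
    simpa using h
  smul_mem' := by
    intro c a ha x
    simp only [Set.mem_setOf_eq, sbr] at ha ⊢
    rw [LieSuper.br_smul_left, ha x, smul_zero]

/-- Homomorphisms of Lie superalgebras: even (grading preserving) linear maps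
which preserve the bracket. -/
def IsHom (F : Type u) [Field F] {L : Type v} {M : Type w}
    [AddCommGroup L] [Module F L] [LieSuper F L]
    [AddCommGroup M] [Module F M] [LieSuper F M] (f : L →ₗ[F] M) : Prop :=
  (∀ a : ZMod 2, ∀ x ∈ grd F L a, f x ∈ grd F M a) ∧
  (∀ x y : L, f (sbr F x y) = sbr F (f x) (f y))

/-- A bundled Lie superalgebra over `F`. -/
structure LieSupAlg (F : Type u) [Field F] : Type (max u (v + 1)) where
  carrier : Type v
  [iag : AddCommGroup carrier]
  [imo : Module F carrier]
  [ils : LieSuper F carrier]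

attribute [instance] LieSupAlg.iag LieSupAlg.imo LieSupAlg.ils

instance (F : Type u) [Field F] : CoeSort (LieSupAlg.{u, v} F) (Type v) :=
  ⟨LieSupAlg.carrier⟩

/-- A Lie superalgebra `L` is capable if `L ≅ H/Z(H)` for some Lie superalgebra `H`,
i.e. there is a surjective homomorphism onto `L` whose kernel is exactly the center. -/
def Capable (F : Type u) [Field F] (L : Type v) [AddCommGroup L] [Module F L]
    [LieSuper F L] : Prop :=
  ∃ (H : LieSupAlg.{u, max u v} F) (φ : H.carrier →ₗ[F] L),
    IsHom F φ ∧ Surjective φ ∧ LinearMap.ker φ = centerS F H.carrier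

/-- Graded ideals of a Lie superalgebra. -/
def IsGIdeal (F : Type u) [Field F] {L : Type v} [AddCommGroup L] [Module F L]
    [LieSuper F L] (I : Submodule F L) : Prop :=
  (∀ x ∈ I, ∀ y : L, sbr F x y ∈ I) ∧ (∀ y : L, ∀ x ∈ I, sbr F y x ∈ I) ∧
  (∀ x ∈ I, ∃ x0 ∈ I ⊓ grd F L 0, ∃ x1 ∈ I ⊓ grd F L 1, x = x0 + x1)

/-- The graded ideal generated by a subset. -/
def idealClosure (F : Type u) [Field F] {L : Type v} [AddCommGroup L] [Module F L]
    [LieSuper F L] (S : Set L) : Submodule F L :=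
  sInf {I : Submodule F L | IsGIdeal F I ∧ S ⊆ ↑I}

/-- `QuotCapable F L N` expresses that the quotient Lie superalgebra `L/N` is capable. -/
def QuotCapable (F : Type u) [Field F] (L : Type v) [AddCommGroup L] [Module F L]
    [LieSuper F L] (N : Submodule F L) : Prop :=
  ∃ (Q : LieSupAlg.{u, max u v} F) (π : L →ₗ[F] Q.carrier),
    IsHom F π ∧ Surjective π ∧ LinearMap.ker π = N ∧ Capable F Q.carrier

/-- The epicenter `Z^*(L)`: the smallest graded ideal of `L` such that the
corresponding quotient is capable. -/
def IsEpicenter (F : Type u) [Field F] (L : Type v) [AddCommGroup L] [Module F L]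
    [LieSuper F L] (Z : Submodule F L) : Prop :=
  IsGIdeal F Z ∧ QuotCapable F L Z ∧
  ∀ N : Submodule F L, IsGIdeal F N → QuotCapable F L N → Z ≤ N

/-- The submodule `[I,J]` spanned by brackets. -/
def bracketSpan (F : Type u) [Field F] {L : Type v} [AddCommGroup L] [Module F L]
    [LieSuper F L] (I J : Submodule F L) : Submodule F L :=
  Submodule.span F {z : L | ∃ x ∈ I, ∃ y ∈ J, z = sbr F x y}

/-- The derived subalgebra `L' = [L,L]`. -/
def derived (F : Type u) [Field F] (L : Type v) [AddCommGroup L] [Module F L]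
    [LieSuper F L] : Submodule F L :=
  bracketSpan F (⊤ : Submodule F L) ⊤

/-- The lower central series of a Lie superalgebra. -/
def lowerCentral (F : Type u) [Field F] (L : Type v) [AddCommGroup L] [Module F L]
    [LieSuper F L] : ℕ → Submodule F L
  | 0 => ⊤
  | n + 1 => bracketSpan F (lowerCentral F L n) ⊤

/-- A Lie superalgebra is nilpotent if its lower central series terminates at zero. -/
def IsNilp (F : Type u) [Field F] (L : Type v) [AddCommGroup L] [Module F L]
    [LieSuper F L] : Prop :=
  ∃ n : ℕ, lowerCentral F L n = ⊥

/-- An action of a Lie superalgebra `P` on a Lie superalgebra `M`: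
an even bilinear map satisfying the two action axioms. -/
structure IsAction (F : Type u) [Field F] {P : Type v} {M : Type v}
    [AddCommGroup P] [Module F P] [LieSuper F P]
    [AddCommGroup M] [Module F M] [LieSuper F M] (act : P → M → M) : Prop where
  add_left : ∀ (p q : P) (m : M), act (p + q) m = act p m + act q m
  add_right : ∀ (p : P) (m m' : M), act p (m + m') = act p m + act p m'
  smul_left : ∀ (c : F) (p : P) (m : M), act (c • p) m = c • act p m
  smul_right : ∀ (c : F) (p : P) (m : M), act p (c • m) = c • act p m
  grade : ∀ a b : ZMod 2, ∀ p ∈ grd F P a, ∀ m ∈ grd F M b, act p m ∈ grd F M (a + b)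
  br_act : ∀ a b : ZMod 2, ∀ p ∈ grd F P a, ∀ p' ∈ grd F P b, ∀ m : M,
    act (sbr F p p') m = act p (act p' m) - sg F a b • act p' (act p m)
  act_br : ∀ a b : ZMod 2, ∀ p ∈ grd F P a, ∀ m ∈ grd F M b, ∀ m' : M,
    act p (sbr F m m') = sbr F (act p m) m' + sg F a b • sbr F m (act p m')

/-- Compatibility of mutual actions of two Lie superalgebras on each other. -/
def Compatible (F : Type u) [Field F] {M : Type v} {N : Type v}
    [AddCommGroup M] [Module F M] [LieSuper F M]
    [AddCommGroup N] [Module F N] [LieSuper F N]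
    (actMN : M → N → N) (actNM : N → M → M) : Prop :=
  (∀ a b : ZMod 2, ∀ m ∈ grd F M a, ∀ n ∈ grd F N b, ∀ n' : N,
      actMN (actNM n m) n' = -(sg F a b) • sbr F (actMN m n) n') ∧
  (∀ a b : ZMod 2, ∀ m ∈ grd F M a, ∀ n ∈ grd F N b, ∀ m' : M,
      actNM (actMN m n) m' = -(sg F a b) • sbr F (actNM n m) m')

/-- The defining relations of the non-abelian tensor product `M ⊗ N` of Lie
superalgebras (with given mutual actions), satisfied by a pairing `q` into `T`. -/
structure TensorRel (F : Type u) [Field F] {M : Type v} {N : Type v} {T : Type w}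
    [AddCommGroup M] [Module F M] [LieSuper F M]
    [AddCommGroup N] [Module F N] [LieSuper F N]
    [AddCommGroup T] [Module F T] [LieSuper F T]
    (actMN : M → N → N) (actNM : N → M → M) (q : M → N → T) : Prop where
  add_left : ∀ (m m' : M) (n : N), q (m + m') n = q m n + q m' n
  add_right : ∀ (m : M) (n n' : N), q m (n + n') = q m n + q m n'
  smul_left : ∀ (c : F) (m : M) (n : N), q (c • m) n = c • q m n
  smul_right : ∀ (c : F) (m : M) (n : N), q m (c • n) = c • q m n
  grade : ∀ a b : ZMod 2, ∀ m ∈ grd F M a, ∀ n ∈ grd F N b, q m n ∈ grd F T (a + b)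
  brk_left : ∀ a b : ZMod 2, ∀ m ∈ grd F M a, ∀ m' ∈ grd F M b, ∀ n : N,
    q (sbr F m m') n = q m (actMN m' n) - sg F a b • q m' (actMN m n)
  brk_right : ∀ a b c : ZMod 2, ∀ m ∈ grd F M a, ∀ n ∈ grd F N b, ∀ n' ∈ grd F N c,
    q m (sbr F n n') = sg F c (a + b) • q (actNM n' m) n - sg F a b • q (actNM n m) n'
  brk_brk : ∀ a b : ZMod 2, ∀ m ∈ grd F M a, ∀ n ∈ grd F N b, ∀ (m' : M) (n' : N),
    sbr F (q m n) (q m' n') = -(sg F a b) • q (actNM n m) (actMN m' n')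

/-- `IsTensorObj F actMN actNM t` says that `(T, t)` is the non-abelian tensor
product `M ⊗ N`: the pairing `t` satisfies the defining relations and is
universal among all pairings satisfying them. -/
structure IsTensorObj (F : Type u) [Field F] {M : Type v} {N : Type v} {T : Type v}
    [AddCommGroup M] [Module F M] [LieSuper F M]
    [AddCommGroup N] [Module F N] [LieSuper F N]
    [AddCommGroup T] [Module F T] [LieSuper F T]
    (actMN : M → N → N) (actNM : N → M → M) (t : M → N → T) : Prop where
  rel : TensorRel F actMN actNM t
  lift : ∀ (Q : LieSupAlg.{u, max u v} F) (q : M → N → Q.carrier),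
    TensorRel F actMN actNM q →
    ∃! h : T →ₗ[F] Q.carrier, IsHom F h ∧ ∀ (m : M) (n : N), h (t m n) = q m n

/-- The defining relations of the non-abelian exterior square `L ∧ L` of a Lie
superalgebra (the tensor relations for the bracket actions, together with the
graded alternating relations coming from `L □ L`). -/
structure ExtRel (F : Type u) [Field F] {L : Type v} {T : Type w}
    [AddCommGroup L] [Module F L] [LieSuper F L]
    [AddCommGroup T] [Module F T] [LieSuper F T] (q : L → L → T) : Prop where
  toTensor : TensorRel F (fun x y : L => sbr F x y) (fun x y : L => sbr F x y) q
  alt : ∀ a b : ZMod 2, ∀ x ∈ grd F L a, ∀ y ∈ grd F L b, q x y = -(sg F a b) • q y x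
  alt_even : ∀ x ∈ grd F L 0, q x x = 0

/-- `IsExtObj F t` says that `(E, t)` is the non-abelian exterior square `L ∧ L`. -/
structure IsExtObj (F : Type u) [Field F] {L : Type v} {E : Type v}
    [AddCommGroup L] [Module F L] [LieSuper F L]
    [AddCommGroup E] [Module F E] [LieSuper F E] (t : L → L → E) : Prop where
  rel : ExtRel F t
  lift : ∀ (Q : LieSupAlg.{u, max u v} F) (q : L → L → Q.carrier),
    ExtRel F q →
    ∃! h : E →ₗ[F] Q.carrier, IsHom F h ∧ ∀ x y : L, h (t x y) = q x y

/-- A free Lie superalgebra: free on some `ℤ₂`-graded subset `X`. -/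
def IsFreeLieSuper (F : Type u) [Field F] (Fr : Type v) [AddCommGroup Fr] [Module F Fr]
    [LieSuper F Fr] : Prop :=
  ∃ X : ZMod 2 → Set Fr,
    (∀ a : ZMod 2, X a ⊆ (grd F Fr a : Set Fr)) ∧
    ∀ (Q : LieSupAlg.{u, max u v} F) (f : ∀ a : ZMod 2, X a → Q.carrier),
      (∀ (a : ZMod 2) (x : X a), f a x ∈ grd F Q.carrier a) →
      ∃! h : Fr →ₗ[F] Q.carrier,
        IsHom F h ∧ ∀ (a : ZMod 2) (x : X a), h (x : Fr) = f a x

/-- `F' ∩ R`, for a free presentation with kernel `R`. -/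
abbrev schurA (F : Type u) [Field F] (Fr : Type v) [AddCommGroup Fr] [Module F Fr]
    [LieSuper F Fr] (R : Submodule F Fr) : Submodule F Fr :=
  derived F Fr ⊓ R

/-- The Schur multiplier `M(L) = (F' ∩ R)/[R,F]` attached to a free presentation
`0 → R → F → L → 0`. -/
abbrev SchurMul (F : Type u) [Field F] (Fr : Type v) [AddCommGroup Fr] [Module F Fr]
    [LieSuper F Fr] (R : Submodule F Fr) :=
  ↥(schurA F Fr R) ⧸ (Submodule.comap (schurA F Fr R).subtype (bracketSpan F R ⊤))

/-- `L` is (isomorphic to) the special Heisenberg Lie superalgebra `H(m,n)` with even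
center: basis `x₁,…,x_{2m}, z` (even), `y₁,…,y_n` (odd), with `[xᵢ, x_{m+i}] = z`,
`[y_j, y_j] = z` and `z` central. -/
def IsHeisE (F : Type u) [Field F] (m n : ℕ) (L : Type v) [AddCommGroup L] [Module F L]
    [LieSuper F L] : Prop :=
  ∃ (x : Fin (2 * m) → L) (y : Fin n → L) (z : L),
    (∀ i, x i ∈ grd F L 0) ∧ z ∈ grd F L 0 ∧ (∀ j, y j ∈ grd F L 1) ∧
    LinearIndependent F (Sum.elim x (Sum.elim y (fun _ : Unit => z))) ∧
    Submodule.span F (Set.range (Sum.elim x (Sum.elim y (fun _ : Unit => z)))) = ⊤ ∧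
    (∀ i j : Fin (2 * m), sbr F (x i) (x j) =
      if (j : ℕ) = (i : ℕ) + m then z else if (i : ℕ) = (j : ℕ) + m then -z else 0) ∧
    (∀ (i : Fin (2 * m)) (j : Fin n), sbr F (x i) (y j) = 0) ∧
    (∀ (i : Fin (2 * m)) (j : Fin n), sbr F (y j) (x i) = 0) ∧
    (∀ i j : Fin n, sbr F (y i) (y j) = if i = j then z else 0) ∧
    (∀ w : L, sbr F z w = 0) ∧ (∀ w : L, sbr F w z = 0)

/-- `L` is (isomorphic to) the Heisenberg Lie superalgebra `H_m` with odd center: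
basis `x₁,…,x_m` (even), `y₁,…,y_m, z` (odd), with `[x_j, y_j] = z` and `z` central. -/
def IsHeisO (F : Type u) [Field F] (m : ℕ) (L : Type v) [AddCommGroup L] [Module F L]
    [LieSuper F L] : Prop :=
  ∃ (x : Fin m → L) (y : Fin m → L) (z : L),
    (∀ i, x i ∈ grd F L 0) ∧ (∀ j, y j ∈ grd F L 1) ∧ z ∈ grd F L 1 ∧
    LinearIndependent F (Sum.elim x (Sum.elim y (fun _ : Unit => z))) ∧
    Submodule.span F (Set.range (Sum.elim x (Sum.elim y (fun _ : Unit => z)))) = ⊤ ∧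
    (∀ i j : Fin m, sbr F (x i) (x j) = 0) ∧
    (∀ i j : Fin m, sbr F (x i) (y j) = if i = j then z else 0) ∧
    (∀ i j : Fin m, sbr F (y j) (x i) = if i = j then -z else 0) ∧
    (∀ i j : Fin m, sbr F (y i) (y j) = 0) ∧
    (∀ w : L, sbr F z w = 0) ∧ (∀ w : L, sbr F w z = 0)

/-- `A` is (isomorphic to) the abelian Lie superalgebra `A(r | s)` of
superdimension `(r | s)`. -/
def IsAbelSuper (F : Type u) [Field F] (r s : ℕ) (A : Type v) [AddCommGroup A]
    [Module F A] [LieSuper F A] : Prop :=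
  (∀ x y : A, sbr F x y = 0) ∧ Module.Finite F A ∧
  Module.finrank F ↥(grd F A 0) = r ∧ Module.finrank F ↥(grd F A 1) = s

/-- The direct sum (product) of two Lie superalgebras. -/
instance prodLieSuper (F : Type u) [Field F] (A : Type v) (B : Type w)
    [AddCommGroup A] [Module F A] [LieSuper F A]
    [AddCommGroup B] [Module F B] [LieSuper F B] : LieSuper F (A × B) where
  gr a := (grd F A a).prod (grd F B a)
  isCompl_gr := by
    have hA : IsCompl (grd F A 0) (grd F A 1) := LieSuper.isCompl_gr
    have hB : IsCompl (grd F B 0) (grd F B 1) := LieSuper.isCompl_gr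
    constructor
    · rw [disjoint_iff, eq_bot_iff]
      rintro ⟨a, b⟩ h
      rw [Submodule.mem_inf] at h
      obtain ⟨h0, h1⟩ := h
      rw [Submodule.mem_prod] at h0 h1
      have ha : a = 0 := by
        have := hA.disjoint.le_bot (Submodule.mem_inf.mpr ⟨h0.1, h1.1⟩)
        simpa using this
      have hb : b = 0 := by
        have := hB.disjoint.le_bot (Submodule.mem_inf.mpr ⟨h0.2, h1.2⟩)
        simpa using this
      simp [ha, hb, Prod.ext_iff]
    · rw [codisjoint_iff, eq_top_iff]
      rintro ⟨a, b⟩ -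
      have ha' : a ∈ grd F A 0 ⊔ grd F A 1 := by
        rw [hA.codisjoint.eq_top]; trivial
      have hb' : b ∈ grd F B 0 ⊔ grd F B 1 := by
        rw [hB.codisjoint.eq_top]; trivial
      obtain ⟨a0, ha0, a1, ha1, rfl⟩ := Submodule.mem_sup.mp ha'
      obtain ⟨b0, hb0, b1, hb1, rfl⟩ := Submodule.mem_sup.mp hb'
      refine Submodule.mem_sup.mpr ⟨(a0, b0), ?_, (a1, b1), ?_, ?_⟩
      · exact Submodule.mem_prod.mpr ⟨ha0, hb0⟩
      · exact Submodule.mem_prod.mpr ⟨ha1, hb1⟩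
      · rfl
  br x y := (sbr F x.1 y.1, sbr F x.2 y.2)
  br_add_left := by
    intro x y z
    simp only [Prod.fst_add, Prod.snd_add, sbr, LieSuper.br_add_left]
    rfl
  br_add_right := by
    intro x y z
    simp only [Prod.fst_add, Prod.snd_add, sbr, LieSuper.br_add_right]
    rfl
  br_smul_left := by
    intro c x y
    simp only [Prod.smul_fst, Prod.smul_snd, sbr, LieSuper.br_smul_left]
    rfl
  br_smul_right := by
    intro c x y
    simp only [Prod.smul_fst, Prod.smul_snd, sbr, LieSuper.br_smul_right]
    rfl
  br_gr := by
    intro a b x hx y hy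
    rw [Submodule.mem_prod] at hx hy ⊢
    exact ⟨LieSuper.br_gr a b x.1 hx.1 y.1 hy.1, LieSuper.br_gr a b x.2 hx.2 y.2 hy.2⟩
  br_skew := by
    intro a b x hx y hy
    rw [Submodule.mem_prod] at hx hy
    have h1 := LieSuper.br_skew (F := F) a b x.1 hx.1 y.1 hy.1
    have h2 := LieSuper.br_skew (F := F) a b x.2 hx.2 y.2 hy.2
    simp only [sbr]
    rw [Prod.ext_iff]
    exact ⟨h1, h2⟩
  br_jacobi := by
    intro a b c x hx y hy z hz
    rw [Submodule.mem_prod] at hx hy hz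
    have h1 := LieSuper.br_jacobi (F := F) a b c x.1 hx.1 y.1 hy.1 z.1 hz.1
    have h2 := LieSuper.br_jacobi (F := F) a b c x.2 hx.2 y.2 hy.2 z.2 hz.2
    simp only [sbr]
    rw [Prod.ext_iff]
    exact ⟨h1, h2⟩

section helpers

theorem zm2 (a : ZMod 2) : a = 0 ∨ a = 1 := by revert a; decide
theorem zm2_11 : (1 : ZMod 2) + 1 = 0 := by decide

theorem sg_zl (F : Type u) [Field F] (b : ZMod 2) : sg F 0 b = 1 := by simp [sg]
theorem sg_zr (F : Type u) [Field F] (b : ZMod 2) : sg F b 0 = 1 := by simp [sg]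
theorem sg_oo (F : Type u) [Field F] : sg F 1 1 = -1 := by
  have : (1 : ZMod 2).val = 1 := by decide
  simp [sg, this]

variable {F : Type u} [Field F]

section one
variable {L : Type v} [AddCommGroup L] [Module F L] [LieSuper F L]

theorem sal (x y z : L) : sbr F (x + y) z = sbr F x z + sbr F y z := LieSuper.br_add_left x y z
theorem sar (x y z : L) : sbr F x (y + z) = sbr F x y + sbr F x z := LieSuper.br_add_right x y z
theorem ssl (c : F) (x y : L) : sbr F (c • x) y = c • sbr F x y := LieSuper.br_smul_left c x y
theorem ssr (c : F) (x y : L) : sbr F x (c • y) = c • sbr F x y := LieSuper.br_smul_right c x y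
theorem sgr {a b : ZMod 2} {x y : L} (hx : x ∈ grd F L a) (hy : y ∈ grd F L b) :
    sbr F x y ∈ grd F L (a + b) := LieSuper.br_gr a b x hx y hy
theorem sskew {a b : ZMod 2} {x y : L} (hx : x ∈ grd F L a) (hy : y ∈ grd F L b) :
    sbr F x y = -(sg F a b) • sbr F y x := LieSuper.br_skew a b x hx y hy
theorem sjac {a b c : ZMod 2} {x y z : L} (hx : x ∈ grd F L a) (hy : y ∈ grd F L b)
    (hz : z ∈ grd F L c) :
    sg F a c • sbr F x (sbr F y z) + sg F b a • sbr F y (sbr F z x)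
      + sg F c b • sbr F z (sbr F x y) = 0 := LieSuper.br_jacobi a b c x hx y hy z hz
theorem snr (x y : L) : sbr F x (-y) = - sbr F x y := by
  have := ssr (F := F) (-1) x y
  simpa using this
theorem snl (x y : L) : sbr F (-x) y = - sbr F x y := by
  have := ssl (F := F) (-1) x y
  simpa using this
theorem szr (x : L) : sbr F x 0 = 0 := by
  have := ssr (F := F) 0 x 0
  simpa using this

theorem sdec (F : Type u) [Field F] {L : Type v} [AddCommGroup L] [Module F L] [LieSuper F L]
    (x : L) : ∃ x0 ∈ grd F L 0, ∃ x1 ∈ grd F L 1, x = x0 + x1 := by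
  have h : IsCompl (grd F L 0) (grd F L 1) := LieSuper.isCompl_gr
  have hx : x ∈ grd F L 0 ⊔ grd F L 1 := by rw [h.codisjoint.eq_top]; trivial
  obtain ⟨a, ha, b, hb, e⟩ := Submodule.mem_sup.mp hx
  exact ⟨a, ha, b, hb, e.symm⟩

theorem sdisj {x y : L} (hx : x ∈ grd F L 0) (hy : y ∈ grd F L 1) (h : x + y = 0) :
    x = 0 ∧ y = 0 := by
  have hc : IsCompl (grd F L 0) (grd F L 1) := LieSuper.isCompl_gr
  have hxy : x = -y := eq_neg_of_add_eq_zero_left h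
  have h1 : x ∈ grd F L 1 := by rw [hxy]; exact neg_mem hy
  have : x = 0 := by simpa using hc.disjoint.le_bot (Submodule.mem_inf.mpr ⟨hx, h1⟩)
  subst this
  exact ⟨rfl, by simpa using h⟩

/-- left central elements are right central -/
theorem scent {z : L} (hz : ∀ x, sbr F z x = 0) (x : L) : sbr F x z = 0 := by
  obtain ⟨z0, h0, z1, h1, rfl⟩ := sdec F z
  have key : ∀ b : ZMod 2, ∀ y ∈ grd F L b, sbr F z0 y = 0 ∧ sbr F z1 y = 0 := by
    intro b y hy
    have e := hz y
    rw [sal] at e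
    have g0 := sgr h0 hy
    have g1 := sgr h1 hy
    rcases zm2 b with rfl | rfl
    · exact sdisj (by simpa using g0) (by simpa using g1) e
    · rw [add_comm] at e
      rw [zm2_11] at g1
      exact (sdisj g1 (by simpa using g0) e).symm
  obtain ⟨x0, k0, x1, k1, rfl⟩ := sdec F x
  simp only [sal, sar]
  rw [sskew k0 h0, sskew k0 h1, sskew k1 h0, sskew k1 h1]
  simp [(key 0 x0 k0).1, (key 0 x0 k0).2, (key 1 x1 k1).1, (key 1 x1 k1).2]

theorem j1 {a b : ZMod 2} {x y : L} (hx : x ∈ grd F L a) (hy : y ∈ grd F L b) (z : L) :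
    sbr F (sbr F x y) z = sbr F x (sbr F y z) - sg F a b • sbr F y (sbr F x z) := by
  have hom : ∀ c : ZMod 2, ∀ z ∈ grd F L c,
      sbr F (sbr F x y) z = sbr F x (sbr F y z) - sg F a b • sbr F y (sbr F x z) := by
    intro c z hz
    have e := sjac hx hy hz
    rw [sskew hz (sgr hx hy), sskew hz hx, ssr] at e
    rcases zm2 a with rfl | rfl <;> rcases zm2 b with rfl | rfl <;>
      rcases zm2 c with rfl | rfl <;>
      simp [sg_zl, sg_zr, sg_oo, zm2_11] at e ⊢ <;>
      first
        | linear_combination (norm := module) (1 : F) • e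
        | linear_combination (norm := module) (-1 : F) • e
  obtain ⟨z0, h0, z1, h1, rfl⟩ := sdec F z
  simp only [sar]
  rw [hom 0 z0 h0, hom 1 z1 h1, smul_add]
  abel

theorem j2 {a b c : ZMod 2} {x y z : L} (hx : x ∈ grd F L a) (hy : y ∈ grd F L b)
    (hz : z ∈ grd F L c) :
    sbr F x (sbr F y z) =
      sg F c (a + b) • sbr F (sbr F z x) y - sg F a b • sbr F (sbr F y x) z := by
  have e := j1 hx hy z
  rw [sskew hx hy, ssl] at e
  rw [sskew (sgr hz hx) hy, sskew hz hx, ssr]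
  rcases zm2 a with rfl | rfl <;> rcases zm2 b with rfl | rfl <;>
      rcases zm2 c with rfl | rfl <;>
      simp [sg_zl, sg_zr, sg_oo, zm2_11] at e ⊢ <;>
      first
        | linear_combination (norm := module) (1 : F) • e
        | linear_combination (norm := module) (-1 : F) • e

end one

theorem extRel_of_central {L : Type v} [AddCommGroup L] [Module F L] [LieSuper F L]
    {Q : Type w} [AddCommGroup Q] [Module F Q] [LieSuper F Q]
    {H : Type w} [AddCommGroup H] [Module F H] [LieSuper F H]
    (hchar2 : (2 : F) ≠ 0)
    (φ : H →ₗ[F] Q) (hφ : IsHom F φ) (hs : Surjective φ) (hk : LinearMap.ker φ ≤ centerS F H)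
    (π : L →ₗ[F] Q) (hπ : IsHom F π) :
    ∃ q : L → L → H, ExtRel F q ∧
      ∀ x y h k, φ h = π x → φ k = π y → q x y = sbr F h k := by
  have hcen : ∀ h, φ h = 0 → ∀ k, sbr F h k = 0 := fun h hh => hk hh
  have hcen' : ∀ h, φ h = 0 → ∀ k, sbr F k h = 0 := fun h hh => scent (hk hh)
  have wd : ∀ h h' k k', φ h = φ h' → φ k = φ k' → sbr F h k = sbr F h' k' := by
    intro h h' k k' e1 e2
    have a1 : h = h' + (h - h') := by abel
    have a2 : k = k' + (k - k') := by abel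
    rw [a1, a2, sal, hcen (h - h') (by simp [e1]), sar, hcen' (k - k') (by simp [e2])]
    simp
  choose s hsec using hs
  obtain ⟨q, hq⟩ : ∃ q : L → L → H, ∀ x y h k, φ h = π x → φ k = π y → q x y = sbr F h k :=
    ⟨fun x y => sbr F (s (π x)) (s (π y)), fun x y h k e1 e2 =>
      wd _ _ _ _ (by rw [hsec, e1]) (by rw [hsec, e2])⟩
  have lft : ∀ x : L, ∃ h, φ h = π x := fun x => ⟨s (π x), hsec _⟩
  have hlft : ∀ a : ZMod 2, ∀ x ∈ grd F L a, ∃ h ∈ grd F H a, φ h = π x := by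
    intro a x hx
    obtain ⟨h, e⟩ := lft x
    obtain ⟨h0, k0, h1, k1, rfl⟩ := sdec F h
    have p := hπ.1 a x hx
    have p0 := hφ.1 0 _ k0
    have p1 := hφ.1 1 _ k1
    rw [map_add] at e
    rcases zm2 a with rfl | rfl
    · refine ⟨h0, k0, ?_⟩
      have := (sdisj (sub_mem p0 p) p1 (by rw [← e]; abel)).1
      exact sub_eq_zero.mp this
    · refine ⟨h1, k1, ?_⟩
      have := (sdisj p0 (sub_mem p1 p) (by rw [← e]; abel)).2
      exact sub_eq_zero.mp this
  have lbr : ∀ {x y h k}, φ h = π x → φ k = π y → φ (sbr F h k) = π (sbr F x y) := by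
    intro x y h k e1 e2
    rw [hφ.2, hπ.2, e1, e2]
  refine ⟨q, ⟨⟨?_, ?_, ?_, ?_, ?_, ?_, ?_, ?_⟩, ?_, ?_⟩, hq⟩
  · intro m m' n
    obtain ⟨h, e⟩ := lft m
    obtain ⟨h', e'⟩ := lft m'
    obtain ⟨k, f⟩ := lft n
    rw [hq _ _ _ _ e f, hq _ _ _ _ e' f, hq (m + m') n (h + h') k (by simp [e, e']) f, sal]
  · intro n m m'
    obtain ⟨h, e⟩ := lft m
    obtain ⟨h', e'⟩ := lft m'
    obtain ⟨k, f⟩ := lft n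
    rw [hq _ _ _ _ f e, hq _ _ _ _ f e', hq n (m + m') k (h + h') f (by simp [e, e']), sar]
  · intro c m n
    obtain ⟨h, e⟩ := lft m
    obtain ⟨k, f⟩ := lft n
    rw [hq _ _ _ _ e f, hq (c • m) n (c • h) k (by simp [e]) f, ssl]
  · intro c m n
    obtain ⟨h, e⟩ := lft m
    obtain ⟨k, f⟩ := lft n
    rw [hq _ _ _ _ e f, hq m (c • n) h (c • k) e (by simp [f]), ssr]
  · intro a b m hm n hn
    obtain ⟨h, gh, e⟩ := hlft a m hm
    obtain ⟨k, gk, f⟩ := hlft b n hn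
    rw [hq _ _ _ _ e f]
    exact sgr gh gk
  · intro a b m hm m' hm' n
    obtain ⟨h, gh, e⟩ := hlft a m hm
    obtain ⟨h', gh', e'⟩ := hlft b m' hm'
    obtain ⟨k, f⟩ := lft n
    rw [hq _ _ _ _ (lbr e e') f, hq _ _ _ _ e (lbr e' f), hq _ _ _ _ e' (lbr e f)]
    exact j1 gh gh' k
  · intro a b c m hm n hn n' hn'
    obtain ⟨h, gh, e⟩ := hlft a m hm
    obtain ⟨k, gk, f⟩ := hlft b n hn
    obtain ⟨k', gk', f'⟩ := hlft c n' hn'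
    rw [hq _ _ _ _ e (lbr f f'), hq _ _ _ _ (lbr f' e) f, hq _ _ _ _ (lbr f e) f']
    exact j2 gh gk gk'
  · intro a b m hm n hn m' n'
    obtain ⟨h, gh, e⟩ := hlft a m hm
    obtain ⟨k, gk, f⟩ := hlft b n hn
    obtain ⟨h', e'⟩ := lft m'
    obtain ⟨k', f'⟩ := lft n'
    rw [hq _ _ _ _ e f, hq _ _ _ _ e' f', hq _ _ _ _ (lbr f e) (lbr e' f'), sskew gh gk, ssl]
  · intro a b m hm n hn
    obtain ⟨h, gh, e⟩ := hlft a m hm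
    obtain ⟨k, gk, f⟩ := hlft b n hn
    rw [hq _ _ _ _ e f, hq _ _ _ _ f e]
    exact sskew gh gk
  · intro m hm
    obtain ⟨h, gh, e⟩ := hlft 0 m hm
    rw [hq _ _ _ _ e e]
    have e := sskew gh gh
    rw [sg_zl, neg_smul, one_smul] at e
    have e2 : (2 : F) • sbr F h h = 0 := by
      rw [two_smul]
      exact eq_neg_iff_add_eq_zero.mp e
    exact (smul_eq_zero.mp e2).resolve_left hchar2

/-- push a Lie superalgebra structure forward along a surjection with graded ideal kernel -/
noncomputable def pushLS {A : Type v} [AddCommGroup A] [Module F A] [LieSuper F A]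
    {B : Type w} [AddCommGroup B] [Module F B] (p : A →ₗ[F] B) (hs : Surjective p)
    (hI : IsGIdeal F (LinearMap.ker p)) : LieSuper F B :=
  have wd : ∀ h h' k k', p h = p h' → p k = p k' → p (sbr F h k) = p (sbr F h' k') := by
    intro h h' k k' e1 e2
    have a1 : h = h' + (h - h') := by abel
    have a2 : k = k' + (k - k') := by abel
    have z1 : ∀ y, p (sbr F (h - h') y) = 0 := fun y => hI.1 _ (by simp [e1]) y
    have z2 : ∀ y, p (sbr F y (k - k')) = 0 := fun y => hI.2.1 y _ (by simp [e2])
    rw [a1, a2, sal, map_add, z1, sar, map_add, z2]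
    simp
  have hq : ∀ h k, p (sbr F (surjInv hs (p h)) (surjInv hs (p k))) = p (sbr F h k) :=
    fun h k => wd _ _ _ _ (surjInv_eq hs _) (surjInv_eq hs _)
  { gr := fun a => (grd F A a).map p
    isCompl_gr := by
      constructor
      · rw [disjoint_iff, eq_bot_iff]
        rintro _ ⟨⟨x, hx, rfl⟩, ⟨y, hy, e⟩⟩
        have hk : x - y ∈ LinearMap.ker p := by simp [e]
        obtain ⟨x0, h0, x1, h1, e'⟩ := hI.2.2 _ hk
        have := (sdisj (sub_mem hx h0.2) (neg_mem (add_mem hy h1.2))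
          (by rw [sub_eq_iff_eq_add] at e'; rw [e']; abel)).1
        have e2 : x = x0 := sub_eq_zero.mp this
        rw [e2]
        exact h0.1
      · rw [codisjoint_iff, eq_top_iff]
        intro b _
        obtain ⟨x, rfl⟩ := hs b
        obtain ⟨x0, h0, x1, h1, rfl⟩ := sdec F x
        rw [map_add]
        exact Submodule.add_mem_sup ⟨x0, h0, rfl⟩ ⟨x1, h1, rfl⟩
    br := fun x y => p (sbr F (surjInv hs x) (surjInv hs y))
    br_add_left := by
      intro x y z
      obtain ⟨x, rfl⟩ := hs x
      obtain ⟨y, rfl⟩ := hs y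
      obtain ⟨z, rfl⟩ := hs z
      rw [← map_add, hq, hq, hq, sal, map_add]
    br_add_right := by
      intro x y z
      obtain ⟨x, rfl⟩ := hs x
      obtain ⟨y, rfl⟩ := hs y
      obtain ⟨z, rfl⟩ := hs z
      rw [← map_add, hq, hq, hq, sar, map_add]
    br_smul_left := by
      intro c x y
      obtain ⟨x, rfl⟩ := hs x
      obtain ⟨y, rfl⟩ := hs y
      rw [← map_smul, hq, hq, ssl, map_smul]
    br_smul_right := by
      intro c x y
      obtain ⟨x, rfl⟩ := hs x
      obtain ⟨y, rfl⟩ := hs y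
      rw [← map_smul, hq, hq, ssr, map_smul]
    br_gr := by
      rintro a b _ ⟨x, hx, rfl⟩ _ ⟨y, hy, rfl⟩
      rw [hq]
      exact ⟨_, sgr hx hy, rfl⟩
    br_skew := by
      rintro a b _ ⟨x, hx, rfl⟩ _ ⟨y, hy, rfl⟩
      rw [hq, hq, sskew hx hy, map_smul]
    br_jacobi := by
      rintro a b c _ ⟨x, hx, rfl⟩ _ ⟨y, hy, rfl⟩ _ ⟨z, hz, rfl⟩
      simp only [hq]
      rw [← map_smul, ← map_smul, ← map_smul, ← map_add, ← map_add, sjac hx hy hz, map_zero] }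

theorem exists_push {A : Type v} [AddCommGroup A] [Module F A] [LieSuper F A]
    (I : Submodule F A) (hI : IsGIdeal F I) :
    ∃ (Q : LieSupAlg.{u, max u v} F) (π : A →ₗ[F] Q.carrier),
      IsHom F π ∧ Surjective π ∧ LinearMap.ker π = I := by
  let p : A →ₗ[F] ULift.{u} (A ⧸ I) := ULift.moduleEquiv.symm.toLinearMap ∘ₗ I.mkQ
  have hs : Surjective p := ULift.moduleEquiv.symm.surjective.comp I.mkQ_surjective
  have hk : LinearMap.ker p = I := by
    rw [LinearEquiv.ker_comp, Submodule.ker_mkQ]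
  have hI' : IsGIdeal F (LinearMap.ker p) := by rw [hk]; exact hI
  letI := pushLS p hs hI'
  refine ⟨⟨ULift.{u} (A ⧸ I)⟩, p, ⟨fun a x hx => ⟨x, hx, rfl⟩, fun x y => ?_⟩, hs, hk⟩
  change p (sbr F x y) = p (sbr F (surjInv hs (p x)) (surjInv hs (p y)))
  have e1 : x - surjInv hs (p x) ∈ LinearMap.ker p := by simp [surjInv_eq hs]
  have e2 : y - surjInv hs (p y) ∈ LinearMap.ker p := by simp [surjInv_eq hs]
  have a1 := hI'.1 _ e1 y
  have a2 := hI'.2.1 (surjInv hs (p x)) _ e2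
  rw [sub_eq_add_neg, sal, snl, ← sub_eq_add_neg, LinearMap.mem_ker, map_sub, sub_eq_zero] at a1
  rw [sub_eq_add_neg, sar, snr, ← sub_eq_add_neg, LinearMap.mem_ker, map_sub, sub_eq_zero] at a2
  exact a1.trans a2

theorem isCompl_prod {A B : Type v} [AddCommGroup A] [Module F A] [LieSuper F A]
    [AddCommGroup B] [Module F B] [LieSuper F B] :
    IsCompl ((grd F A 0).prod (grd F B 0)) ((grd F A 1).prod (grd F B 1)) :=
  (prodLieSuper F A B).isCompl_gr

/-- central extension of `L` by `E` along the universal cocycle -/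
def extLS {L E : Type v} [AddCommGroup L] [Module F L] [LieSuper F L]
    [AddCommGroup E] [Module F E] [LieSuper F E] (t : L → L → E) (ht : ExtRel F t) :
    LieSuper F (ULift.{u} (L × E)) where
  gr a := ((grd F L a).prod (grd F E a)).map
    (ULift.moduleEquiv.{u} (R := F) (M := L × E)).symm.toLinearMap
  isCompl_gr := by
    exact (Submodule.orderIsoMapComap
      (ULift.moduleEquiv.{u} (R := F) (M := L × E)).symm).isCompl isCompl_prod
  br x y := ⟨(sbr F x.down.1 y.down.1, t x.down.1 y.down.1)⟩
  br_add_left x y z := by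
    apply ULift.ext
    exact Prod.ext (sal _ _ _) (ht.toTensor.add_left _ _ _)
  br_add_right x y z := by
    apply ULift.ext
    exact Prod.ext (sar _ _ _) (ht.toTensor.add_right _ _ _)
  br_smul_left c x y := by
    apply ULift.ext
    exact Prod.ext (ssl _ _ _) (ht.toTensor.smul_left _ _ _)
  br_smul_right c x y := by
    apply ULift.ext
    exact Prod.ext (ssr _ _ _) (ht.toTensor.smul_right _ _ _)
  br_gr := by
    rintro a b _ ⟨x, hx, rfl⟩ _ ⟨y, hy, rfl⟩
    exact ⟨(sbr F x.1 y.1, t x.1 y.1),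
      ⟨sgr hx.1 hy.1, ht.toTensor.grade a b _ hx.1 _ hy.1⟩, rfl⟩
  br_skew := by
    rintro a b _ ⟨x, hx, rfl⟩ _ ⟨y, hy, rfl⟩
    apply ULift.ext
    exact Prod.ext (sskew hx.1 hy.1) (ht.alt a b _ hx.1 _ hy.1)
  br_jacobi := by
    rintro a b c _ ⟨x, hx, rfl⟩ _ ⟨y, hy, rfl⟩ _ ⟨z, hz, rfl⟩
    apply ULift.ext
    refine Prod.ext (sjac hx.1 hy.1 hz.1) ?_
    change sg F a c • t x.1 (sbr F y.1 z.1) + sg F b a • t y.1 (sbr F z.1 x.1)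
      + sg F c b • t z.1 (sbr F x.1 y.1) = 0
    have e := ht.toTensor.brk_left a b _ hx.1 _ hy.1 z.1
    rw [ht.alt c (a + b) _ hz.1 _ (sgr hx.1 hy.1), e, sskew hz.1 hx.1, ht.toTensor.smul_right]
    rcases zm2 a with rfl | rfl <;> rcases zm2 b with rfl | rfl <;>
      rcases zm2 c with rfl | rfl <;>
      simp [sg_zl, sg_zr, sg_oo, zm2_11] <;> abel

end helpers

/-- for any finite-dimensional Lie superalgebra `L`, the epicenter
equals the exterior center: `Z*(L) = Z∧(L)`. -/
theorem epicenter_eq_exterior_center (F : Type u) [Field F]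
    (hchar2 : (2 : F) ≠ 0) (hchar3 : (3 : F) ≠ 0)
    (L : Type v) [AddCommGroup L] [Module F L] [LieSuper F L]
    [FiniteDimensional F L]
    (Z : Submodule F L) (hZ : IsEpicenter F L Z)
    -- the exterior square `L ∧ L`:
    (E : Type v) [AddCommGroup E] [Module F E] [LieSuper F E]
    (t : L → L → E) (hE : IsExtObj F t) :
    (Z : Set L) = {x : L | ∀ y : L, t x y = 0} := by
  classical
  have ht := hE.rel
  have tgr := ht.toTensor.grade
  -- `t x y = 0` for all `y` forces `x` central
  have hcen : ∀ x, (∀ y, t x y = 0) → ∀ y, sbr F x y = 0 := by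
    intro x hx y
    have hb : IsGIdeal F (⊥ : Submodule F L) := by
      refine ⟨?_, ?_, ?_⟩
      · rintro x hx y
        rw [Submodule.mem_bot] at hx ⊢
        subst hx
        exact (centerS F L).zero_mem y
      · rintro y x hx
        rw [Submodule.mem_bot] at hx ⊢
        subst hx
        exact szr y
      · rintro x hx
        rw [Submodule.mem_bot] at hx
        exact ⟨0, zero_mem _, 0, zero_mem _, by simp [hx]⟩
    obtain ⟨Q, π, hπ, hs, hk⟩ := exists_push (F := F) (⊥ : Submodule F L) hb
    obtain ⟨q, hq, hq'⟩ := extRel_of_central hchar2 (LinearMap.id : Q.carrier →ₗ[F] Q.carrier)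
      ⟨fun _ _ h => h, fun _ _ => rfl⟩ surjective_id (by simp) π hπ
    obtain ⟨h, ⟨_, hh⟩, _⟩ := hE.lift Q q hq
    have e := hh x y
    rw [hx, map_zero, hq' x y (π x) (π y) rfl rfl, ← hπ.2] at e
    have : sbr F x y ∈ LinearMap.ker π := e.symm
    rwa [hk, Submodule.mem_bot] at this
  have tz : ∀ y, t 0 y = 0 := fun y => by
    have := ht.toTensor.smul_left 0 0 y
    simpa using this
  let N : Submodule F L :=
    { carrier := {x : L | ∀ y : L, t x y = 0}
      add_mem' := fun {a b} ha hb y => by rw [ht.toTensor.add_left, ha y, hb y, add_zero]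
      zero_mem' := tz
      smul_mem' := fun c x hx y => by rw [ht.toTensor.smul_left, hx y, smul_zero] }
  have hN : IsGIdeal F N := by
    refine ⟨?_, ?_, ?_⟩
    · intro x hx y
      rw [hcen x hx y]
      exact N.zero_mem
    · intro y x hx
      rw [scent (hcen x hx) y]
      exact N.zero_mem
    · intro x hx
      obtain ⟨x0, h0, x1, h1, rfl⟩ := sdec F x
      have key : ∀ b : ZMod 2, ∀ y ∈ grd F L b, t x0 y = 0 ∧ t x1 y = 0 := by
        intro b y hy
        have e := hx y
        rw [ht.toTensor.add_left] at e
        have g0 := tgr _ _ _ h0 _ hy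
        have g1 := tgr _ _ _ h1 _ hy
        rcases zm2 b with rfl | rfl
        · exact sdisj (by simpa using g0) (by simpa using g1) e
        · rw [add_comm] at e
          rw [zm2_11] at g1
          exact (sdisj g1 (by simpa using g0) e).symm
      refine ⟨x0, ⟨fun y => ?_, h0⟩, x1, ⟨fun y => ?_, h1⟩, rfl⟩
      · obtain ⟨y0, k0, y1, k1, rfl⟩ := sdec F y
        rw [ht.toTensor.add_right, (key 0 _ k0).1, (key 1 _ k1).1, add_zero]
      · obtain ⟨y0, k0, y1, k1, rfl⟩ := sdec F y
        rw [ht.toTensor.add_right, (key 0 _ k0).2, (key 1 _ k1).2, add_zero]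
  have hNc : QuotCapable F L N := by
    obtain ⟨Q, π, hπ, hs, hk⟩ := exists_push (F := F) N hN
    refine ⟨Q, π, hπ, hs, hk, ?_⟩
    letI := extLS t ht
    refine ⟨⟨ULift.{u} (L × E)⟩,
      π ∘ₗ LinearMap.fst F L E ∘ₗ (ULift.moduleEquiv.{u} (R := F) (M := L × E)).toLinearMap,
      ⟨?_, ?_⟩, ?_, ?_⟩
    · rintro a _ ⟨x, hx, rfl⟩
      exact hπ.1 a _ hx.1
    · intro x y
      exact hπ.2 x.down.1 y.down.1
    · intro z
      obtain ⟨x, rfl⟩ := hs z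
      exact ⟨⟨(x, 0)⟩, rfl⟩
    · ext ⟨x, e⟩
      have : π x = 0 ↔ x ∈ N := by rw [← hk]; rfl
      change π x = 0 ↔ _
      rw [this]
      constructor
      · intro hx y
        apply ULift.ext
        exact Prod.ext (hcen x hx _) (hx _)
      · intro hx y
        have := congrArg (fun z : ULift.{u} (L × E) => z.down.2) (hx ⟨(y, 0)⟩)
        exact this
  apply Set.Subset.antisymm
  · intro x hx
    exact hZ.2.2 N hN hNc hx
  · intro x hx
    obtain ⟨Q, π, hπ, hs, hk, H, φ, hφ, hsφ, hkφ⟩ := hZ.2.1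
    obtain ⟨q, hq, hq'⟩ := extRel_of_central hchar2 φ hφ hsφ hkφ.le π hπ
    obtain ⟨h, ⟨_, hh⟩, _⟩ := hE.lift H q hq
    obtain ⟨k, ek⟩ := hsφ (π x)
    have : k ∈ LinearMap.ker φ := by
      rw [hkφ]
      intro l
      obtain ⟨y, ey⟩ := hs (φ l)
      rw [← hq' x y k l ek ey.symm, ← hh, hx y, map_zero]
    have e : x ∈ LinearMap.ker π := by
      rw [LinearMap.mem_ker, ← ek]
      exact this
    rw [hk] at e
    exact e

end SuperLie
end

section
/- Let N be a graded ideal of a Lie superalgebra L over a field F (char F ≠ 2,3). Then N ⊆ Z∧(L) if and only if the natural map L ∧ L → (L/N) ∧ (L/N) is a monomorphism. -/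
/-!
Common definitions: Lie superalgebras over a field `F` (char ≠ 2,3 where needed),
graded ideals, centers, capability, epicenter, non-abelian tensor and exterior
products (characterized by generators-and-relations universal properties),
free Lie superalgebras, Schur multipliers, Heisenberg Lie superalgebras, etc.
-/

namespace SuperLie

open Submodule Function Module

universe u v w

/-- Universe lift of a Lie superalgebra. -/
def uliftLS (F : Type u) [Field F] (E : Type v)
    [AddCommGroup E] [Module F E] [LieSuper F E] : LieSuper F (ULift.{u} E) where
  gr a := (grd F E a).comap (ULift.moduleEquiv (R := F) (M := E)).toLinearMap
  isCompl_gr := by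
    have hA : IsCompl (grd F E 0) (grd F E 1) := LieSuper.isCompl_gr
    constructor
    · rw [disjoint_iff, eq_bot_iff]
      rintro ⟨a⟩ h
      obtain ⟨h0, h1⟩ := Submodule.mem_inf.mp h
      have ha : a = 0 := by
        have := hA.disjoint.le_bot (Submodule.mem_inf.mpr ⟨h0, h1⟩)
        simpa using this
      subst ha
      exact Submodule.zero_mem _
    · rw [codisjoint_iff, eq_top_iff]
      rintro ⟨a⟩ -
      have ha' : a ∈ grd F E 0 ⊔ grd F E 1 := by
        rw [hA.codisjoint.eq_top]; trivial
      obtain ⟨a0, ha0, a1, ha1, rfl⟩ := Submodule.mem_sup.mp ha'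
      exact Submodule.mem_sup.mpr ⟨⟨a0⟩, ha0, ⟨a1⟩, ha1, rfl⟩
  br x y := ⟨sbr F x.down y.down⟩
  br_add_left x y z := congrArg ULift.up (LieSuper.br_add_left (F := F) x.down y.down z.down)
  br_add_right x y z := congrArg ULift.up (LieSuper.br_add_right (F := F) x.down y.down z.down)
  br_smul_left c x y := congrArg ULift.up (LieSuper.br_smul_left (F := F) c x.down y.down)
  br_smul_right c x y := congrArg ULift.up (LieSuper.br_smul_right (F := F) c x.down y.down)
  br_gr a b x hx y hy := LieSuper.br_gr (F := F) a b x.down hx y.down hy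
  br_skew a b x hx y hy :=
    congrArg ULift.up (LieSuper.br_skew (F := F) a b x.down hx y.down hy)
  br_jacobi a b c x hx y hy z hz :=
    congrArg ULift.up (LieSuper.br_jacobi (F := F) a b c x.down hx y.down hy z.down hz)

/-- Bundled universe lift. -/
def uliftAlg (F : Type u) [Field F] (E : Type v)
    [AddCommGroup E] [Module F E] [LieSuper F E] : LieSupAlg.{u, max u v} F :=
  letI := uliftLS F E
  ⟨ULift.{u} E⟩

/-- The linear map into the universe lift. -/
def upLin (F : Type u) [Field F] (E : Type v)
    [AddCommGroup E] [Module F E] [LieSuper F E] : E →ₗ[F] (uliftAlg F E).carrier :=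
  (ULift.moduleEquiv (R := F) (M := E)).symm.toLinearMap

theorem upLin_inj (F : Type u) [Field F] (E : Type v)
    [AddCommGroup E] [Module F E] [LieSuper F E] : Injective (upLin F E) :=
  (ULift.moduleEquiv (R := F) (M := E)).symm.injective

theorem upLin_hom (F : Type u) [Field F] (E : Type v)
    [AddCommGroup E] [Module F E] [LieSuper F E] : IsHom F (upLin F E) :=
  ⟨fun _ _ hx => hx, fun _ _ => rfl⟩

theorem ExtRel.map {F : Type u} [Field F] {L : Type v} {T : Type v} {T' : Type w}
    [AddCommGroup L] [Module F L] [LieSuper F L]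
    [AddCommGroup T] [Module F T] [LieSuper F T]
    [AddCommGroup T'] [Module F T'] [LieSuper F T'] {q : L → L → T} (h : ExtRel F q)
    (f : T →ₗ[F] T') (hf : IsHom F f) : ExtRel F (fun x y => f (q x y)) where
  toTensor :=
    { add_left := fun m m' n => by rw [h.toTensor.add_left, map_add]
      add_right := fun m m' n => by rw [h.toTensor.add_right, map_add]
      smul_left := fun m m' n => by rw [h.toTensor.smul_left, map_smul]
      smul_right := fun m m' n => by rw [h.toTensor.smul_right, map_smul]
      grade := fun a b m hm n hn => hf.1 _ _ (h.toTensor.grade a b m hm n hn)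
      brk_left := fun a b m hm m' hm' n => by
        rw [h.toTensor.brk_left a b m hm m' hm' n, map_sub, map_smul]
      brk_right := fun a b c m hm n hn n' hn' => by
        rw [h.toTensor.brk_right a b c m hm n hn n' hn', map_sub, map_smul, map_smul]
      brk_brk := fun a b m hm n hn m' n' => by
        rw [← hf.2, h.toTensor.brk_brk a b m hm n hn m' n', map_smul] }
  alt := fun a b x hx y hy => by rw [h.alt a b x hx y hy, map_smul]
  alt_even := fun x hx => by rw [h.alt_even x hx, map_zero]

theorem exists_hom_lift {F : Type u} [Field F] {L : Type v} {Q : Type v}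
    [AddCommGroup L] [Module F L] [LieSuper F L]
    [AddCommGroup Q] [Module F Q] [LieSuper F Q]
    (q : L →ₗ[F] Q) (hq : IsHom F q) (hqs : Surjective q) (i : ZMod 2) (a : Q)
    (ha : a ∈ grd F Q i) : ∃ l ∈ grd F L i, q l = a := by
  obtain ⟨x, rfl⟩ := hqs a
  have hA : IsCompl (grd F L 0) (grd F L 1) := LieSuper.isCompl_gr
  have hB : IsCompl (grd F Q 0) (grd F Q 1) := LieSuper.isCompl_gr
  have hx : x ∈ grd F L 0 ⊔ grd F L 1 := by
    rw [hA.codisjoint.eq_top]; trivial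
  obtain ⟨x0, h0, x1, h1, rfl⟩ := Submodule.mem_sup.mp hx
  have k0 := hq.1 0 x0 h0
  have k1 := hq.1 1 x1 h1
  rw [map_add] at ha ⊢
  have hi : i = 0 ∨ i = 1 := by clear ha; revert i; decide
  rcases hi with rfl | rfl
  · refine ⟨x0, h0, ?_⟩
    have h2 : q x1 ∈ grd F Q 0 := by
      have := Submodule.sub_mem _ ha k0
      rwa [add_sub_cancel_left] at this
    have := hB.disjoint.le_bot (Submodule.mem_inf.mpr ⟨h2, k1⟩)
    rw [(Submodule.mem_bot F).mp this, add_zero]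
  · refine ⟨x1, h1, ?_⟩
    have h2 : q x0 ∈ grd F Q 1 := by
      have := Submodule.sub_mem _ ha k1
      rwa [add_sub_cancel_right] at this
    have := hB.disjoint.le_bot (Submodule.mem_inf.mpr ⟨k0, h2⟩)
    rw [(Submodule.mem_bot F).mp this, zero_add]

theorem ExtRel.descend {F : Type u} [Field F] {L : Type v} {Q : Type v} {T : Type v}
    [AddCommGroup L] [Module F L] [LieSuper F L]
    [AddCommGroup Q] [Module F Q] [LieSuper F Q]
    [AddCommGroup T] [Module F T] [LieSuper F T]
    (q : L →ₗ[F] Q) (hq : IsHom F q) (hqs : Surjective q)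
    {t : L → L → T} (h : ExtRel F t) (p : Q → Q → T)
    (hp : ∀ x y, p (q x) (q y) = t x y) : ExtRel F p := by
  have hl := exists_hom_lift q hq hqs
  refine ⟨⟨?_, ?_, ?_, ?_, ?_, ?_, ?_, ?_⟩, ?_, ?_⟩
  · intro m m' n
    obtain ⟨m, rfl⟩ := hqs m
    obtain ⟨m', rfl⟩ := hqs m'
    obtain ⟨n, rfl⟩ := hqs n
    rw [← map_add]; simp only [hp]; exact h.toTensor.add_left _ _ _
  · intro m m' n
    obtain ⟨m, rfl⟩ := hqs m
    obtain ⟨m', rfl⟩ := hqs m'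
    obtain ⟨n, rfl⟩ := hqs n
    rw [← map_add]; simp only [hp]; exact h.toTensor.add_right _ _ _
  · intro c m n
    obtain ⟨m, rfl⟩ := hqs m
    obtain ⟨n, rfl⟩ := hqs n
    rw [← map_smul]; simp only [hp]; exact h.toTensor.smul_left _ _ _
  · intro c m n
    obtain ⟨m, rfl⟩ := hqs m
    obtain ⟨n, rfl⟩ := hqs n
    rw [← map_smul]; simp only [hp]; exact h.toTensor.smul_right _ _ _
  · intro a b m hm n hn
    obtain ⟨m, khm, rfl⟩ := hl a m hm
    obtain ⟨n, khn, rfl⟩ := hl b n hn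
    rw [hp]; exact h.toTensor.grade a b m khm n khn
  · intro a b m hm m' hm' n
    obtain ⟨m, khm, rfl⟩ := hl a m hm
    obtain ⟨m', khm', rfl⟩ := hl b m' hm'
    obtain ⟨n, rfl⟩ := hqs n
    simp only [← hq.2, hp]; exact h.toTensor.brk_left a b m khm m' khm' n
  · intro a b c m hm n hn n' hn'
    obtain ⟨m, khm, rfl⟩ := hl a m hm
    obtain ⟨n, khn, rfl⟩ := hl b n hn
    obtain ⟨n', khn', rfl⟩ := hl c n' hn'
    simp only [← hq.2, hp]; exact h.toTensor.brk_right a b c m khm n khn n' khn'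
  · intro a b m hm n hn m' n'
    obtain ⟨m, khm, rfl⟩ := hl a m hm
    obtain ⟨n, khn, rfl⟩ := hl b n hn
    obtain ⟨m', rfl⟩ := hqs m'
    obtain ⟨n', rfl⟩ := hqs n'
    simp only [← hq.2, hp]; exact h.toTensor.brk_brk a b m khm n khn m' n'
  · intro a b m hm n hn
    obtain ⟨m, khm, rfl⟩ := hl a m hm
    obtain ⟨n, khn, rfl⟩ := hl b n hn
    simp only [hp]; exact h.alt a b m khm n khn
  · intro m hm
    obtain ⟨m, khm, rfl⟩ := hl 0 m hm
    rw [hp]; exact h.alt_even m khm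

/-- let `N` be a graded ideal of `L`.  Then `N ⊆ Z∧(L)` if and
only if the natural map `L ∧ L → (L/N) ∧ (L/N)` is a monomorphism. -/
theorem ideal_le_exterior_center_iff (F : Type u) [Field F]
    (hchar2 : (2 : F) ≠ 0) (hchar3 : (3 : F) ≠ 0)
    (L : Type v) [AddCommGroup L] [Module F L] [LieSuper F L]
    (N : Submodule F L) (hN : IsGIdeal F N)
    -- the quotient `L/N`:
    (Q : Type v) [AddCommGroup Q] [Module F Q] [LieSuper F Q]
    (q : L →ₗ[F] Q) (hq : IsHom F q) (hqs : Surjective q)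
    (hker : LinearMap.ker q = N)
    -- the exterior squares `L ∧ L` and `(L/N) ∧ (L/N)`:
    (E : Type v) [AddCommGroup E] [Module F E] [LieSuper F E]
    (t : L → L → E) (hE : IsExtObj F t)
    (E' : Type v) [AddCommGroup E'] [Module F E'] [LieSuper F E']
    (t' : Q → Q → E') (hE' : IsExtObj F t')
    -- the natural map `L ∧ L → (L/N) ∧ (L/N)`:
    (θ : E →ₗ[F] E') (hθ : IsHom F θ)
    (hθt : ∀ x y : L, θ (t x y) = t' (q x) (q y)) :
    (∀ x ∈ N, ∀ y : L, t x y = 0) ↔ Injective θ := by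
  have T := hE.rel.toTensor
  have T' := hE'.rel.toTensor
  constructor
  · intro hz
    have hz' : ∀ x ∈ N, ∀ y : L, t y x = 0 := by
      intro x hx y
      have key : ∀ a b : ZMod 2, ∀ x ∈ N, x ∈ grd F L a → ∀ y ∈ grd F L b, t y x = 0 := by
        intro a b x hx hxa y hy
        rw [hE.rel.alt b a y hy x hxa, hz x hx y, smul_zero]
      obtain ⟨x0, h0, x1, h1, rfl⟩ := hN.2.2 x hx
      have hA : IsCompl (grd F L 0) (grd F L 1) := LieSuper.isCompl_gr
      have hy : y ∈ grd F L 0 ⊔ grd F L 1 := by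
        rw [hA.codisjoint.eq_top]; trivial
      obtain ⟨y0, k0, y1, k1, rfl⟩ := Submodule.mem_sup.mp hy
      rw [T.add_left, T.add_right, T.add_right,
        key 0 0 x0 h0.1 h0.2 y0 k0, key 0 1 x0 h0.1 h0.2 y1 k1,
        key 1 0 x1 h1.1 h1.2 y0 k0, key 1 1 x1 h1.1 h1.2 y1 k1]
      simp
    have hwd : ∀ x x' y y' : L, q x = q x' → q y = q y' → t x y = t x' y' := by
      intro x x' y y' hx hy
      have ex : x - x' ∈ N := by rw [← hker, LinearMap.mem_ker, map_sub, hx, sub_self]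
      have ey : y - y' ∈ N := by rw [← hker, LinearMap.mem_ker, map_sub, hy, sub_self]
      have e1 := T.add_left (x - x') x' y
      have e2 := T.add_right x' (y - y') y'
      rw [sub_add_cancel, hz _ ex, zero_add] at e1
      rw [sub_add_cancel, hz' _ ey, zero_add] at e2
      rw [e1, e2]
    have hp := ExtRel.descend q hq hqs hE.rel
      (fun a b => t (surjInv hqs a) (surjInv hqs b))
      (fun x y => hwd _ _ _ _ (surjInv_eq hqs _) (surjInv_eq hqs _))
    obtain ⟨h, ⟨hh, hht⟩, -⟩ := hE'.lift (uliftAlg F E) _ (hp.map (upLin F E) (upLin_hom F E))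
    have huniq := (hE.lift (uliftAlg F E) _ (hE.rel.map (upLin F E) (upLin_hom F E))).unique
      (y₁ := h ∘ₗ θ) (y₂ := upLin F E)
      ⟨⟨fun a x hx => hh.1 a _ (hθ.1 a x hx), fun x y => by
        rw [LinearMap.comp_apply, hθ.2, hh.2]; rfl⟩, fun x y => by
        rw [LinearMap.comp_apply, hθt, hht]
        exact congrArg _ (hwd _ _ _ _ (surjInv_eq hqs _) (surjInv_eq hqs _))⟩
      ⟨upLin_hom F E, fun _ _ => rfl⟩
    intro x y hxy
    apply upLin_inj F E
    rw [← huniq, LinearMap.comp_apply, LinearMap.comp_apply, hxy]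
  · intro hinj x hx y
    apply hinj
    have hx0 : q x = 0 := by rwa [← hker, LinearMap.mem_ker] at hx
    have := T'.smul_left 0 0 (q y)
    rw [zero_smul, zero_smul] at this
    rw [hθt, hx0, map_zero, this]

end SuperLie
end

section
/- For m + n ≥ 1, the abelian Lie superalgebra A(m | n) over a field F (char F ≠ 2,3) is capable if and only if (m = 0 and n = 1) or m + n ≥ 2. In particular, A(1 | 0) is not capable. -/
/-!
Common definitions: Lie superalgebras over a field `F` (char ≠ 2,3 where needed),
graded ideals, centers, capability, epicenter, non-abelian tensor and exterior
products (characterized by generators-and-relations universal properties),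
free Lie superalgebras, Schur multipliers, Heisenberg Lie superalgebras, etc.
-/

namespace SuperLie

open Submodule Function Module

universe u v w

theorem notCapable_one_zero (F : Type u) [Field F] (hchar2 : (2 : F) ≠ 0)
    (L : LieSupAlg.{u, v} F) (hL : IsAbelSuper F 1 0 L.carrier) : ¬ Capable F L.carrier := by
  obtain ⟨_, hfin, h0, h1⟩ := hL
  rintro ⟨H, φ, ⟨hgr, _⟩, hsurj, hker⟩
  have hL1 : grd F L.carrier 1 = ⊥ := Submodule.finrank_eq_zero.mp h1
  have hz : ∀ z, φ z = 0 → ∀ x, LieSuper.br (F := F) z x = 0 := by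
    intro z hz x
    have : z ∈ centerS F H.carrier := by rw [← hker]; exact hz
    exact this x
  have hodd : ∀ w ∈ grd F H.carrier 1, φ w = 0 := by
    intro w hw
    have := hgr 1 w hw
    rw [hL1] at this
    simpa using this
  have hdec : ∀ w : H.carrier, ∃ w0 ∈ grd F H.carrier 0, ∃ w1 ∈ grd F H.carrier 1,
      w0 + w1 = w := by
    intro w
    have hc : IsCompl (grd F H.carrier 0) (grd F H.carrier 1) := LieSuper.isCompl_gr
    have : w ∈ grd F H.carrier 0 ⊔ grd F H.carrier 1 := by rw [hc.codisjoint.eq_top]; trivial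
    exact Submodule.mem_sup.mp this
  obtain ⟨l, hl0, hl⟩ := finrank_eq_one_iff'.mp h0
  obtain ⟨h, hh⟩ := hsurj l.1
  obtain ⟨a, ha, b, hb, rfl⟩ := hdec h
  have hφa : φ a = l.1 := by rw [← hh, map_add, hodd b hb, add_zero]
  have haa : LieSuper.br (F := F) a a = 0 := by
    have := LieSuper.br_skew (F := F) 0 0 a ha a ha
    simp only [sg, ZMod.val_zero, mul_zero, pow_zero, neg_smul, one_smul] at this
    have h2 : (2 : F) • LieSuper.br (F := F) a a = 0 := by
      rw [two_smul]; nth_rewrite 1 [this]; simp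
    exact (smul_eq_zero.mp h2).resolve_left hchar2
  have hcomm : ∀ d : ZMod 2, ∀ z ∈ grd F H.carrier d, φ z = 0 →
      LieSuper.br (F := F) a z = 0 := by
    intro d z hzd hz0
    rw [LieSuper.br_skew (F := F) 0 d a ha z hzd, hz z hz0, smul_zero]
  have hcen : a ∈ centerS F H.carrier := by
    intro w
    obtain ⟨w0, hw0, w1, hw1, rfl⟩ := hdec w
    obtain ⟨c, hc⟩ := hl ⟨φ w0, hgr 0 w0 hw0⟩
    have hc' : c • l.1 = φ w0 := congrArg Subtype.val hc
    have e : w0 = c • a + (w0 - c • a) := by abel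
    show LieSuper.br (F := F) a (w0 + w1) = 0
    rw [LieSuper.br_add_right, hcomm 1 w1 hw1 (hodd w1 hw1), e, LieSuper.br_add_right,
      LieSuper.br_smul_right, haa,
      hcomm 0 (w0 - c • a) (sub_mem hw0 (Submodule.smul_mem _ c ha))
        (by rw [map_sub, map_smul, hφa, hc', sub_self])]
    simp
  rw [← hker] at hcen
  apply hl0
  apply Subtype.ext
  rw [← hφa]
  exact hcen

/-- A sign attached to a pair of degrees. -/
theorem sg_mul_self (F : Type u) [Field F] (a b : ZMod 2) : sg F a b * sg F a b = 1 := by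
  unfold sg
  rw [← mul_pow]; simp

theorem sg_comm (F : Type u) [Field F] (a b : ZMod 2) : sg F a b = sg F b a := by
  unfold sg
  rw [mul_comm]

theorem exists_homog_basis (F : Type u) [Field F] (L : Type v) [AddCommGroup L] [Module F L]
    [LieSuper F L] [Module.Finite F L] :
    ∃ B : Basis (Fin (finrank F (grd F L 0)) ⊕ Fin (finrank F (grd F L 1))) F L,
      ∀ a : ZMod 2, ∀ x ∈ grd F L a, ∀ i,
        Sum.elim (fun _ => (0 : ZMod 2)) (fun _ => 1) i ≠ a → B.repr x i = 0 := by
  have hc : IsCompl (grd F L 0) (grd F L 1) := LieSuper.isCompl_gr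
  refine ⟨((finBasis F (grd F L 0)).prod (finBasis F (grd F L 1))).map
    (Submodule.prodEquivOfIsCompl _ _ hc), ?_⟩
  intro a x hx i hi
  have h2 : a = 0 ∨ a = 1 := (by decide : ∀ a : ZMod 2, a = 0 ∨ a = 1) a
  rcases h2 with rfl | rfl
  · have e : (Submodule.prodEquivOfIsCompl _ _ hc).symm x = (⟨x, hx⟩, 0) :=
      Submodule.prodEquivOfIsCompl_symm_apply_left _ _ hc ⟨x, hx⟩
    rcases i with i | i
    · simp at hi
    · simp [e]
  · have e : (Submodule.prodEquivOfIsCompl _ _ hc).symm x = (0, ⟨x, hx⟩) :=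
      Submodule.prodEquivOfIsCompl_symm_apply_right _ _ hc ⟨x, hx⟩
    rcases i with i | i
    · simp [e]
    · simp at hi

/-- The degree `a` part of the space of matrices. -/
def matGr (F : Type u) [Field F] {ι : Type} (d : ι → ZMod 2) (a : ZMod 2) :
    Submodule F (ι → ι → F) where
  carrier := {f | ∀ i j, d i + d j ≠ a → f i j = 0}
  add_mem' := by
    intro f g hf hg i j h
    simp [hf i j h, hg i j h]
  zero_mem' := by intro i j _; rfl
  smul_mem' := by
    intro c f hf i j h
    simp [hf i j h]

/-- The universal-type graded-skew pairing. -/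
def matBr (F : Type u) [Field F] {ι : Type} (d : ι → ZMod 2) (x y : ι → F) : ι → ι → F :=
  fun i j => x i * y j - sg F (d i) (d j) * (y i * x j)

theorem matGr_isCompl (F : Type u) [Field F] {ι : Type} (d : ι → ZMod 2) :
    IsCompl (matGr F d 0) (matGr F d 1) := by
  constructor
  · rw [Submodule.disjoint_def]
    intro f h0 h1
    ext i j
    by_cases h : d i + d j = 0
    · exact h1 i j (by rw [h]; decide)
    · exact h0 i j h
  · rw [codisjoint_iff, eq_top_iff]
    rintro f -
    refine Submodule.mem_sup.mpr ⟨fun i j => if d i + d j = 0 then f i j else 0, ?_,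
      fun i j => if d i + d j = 0 then 0 else f i j, ?_, ?_⟩
    · intro i j h; simp [h]
    · intro i j h
      have : ∀ z : ZMod 2, z ≠ 1 → z = 0 := by decide
      simp [this _ h]
    · ext i j
      by_cases h : d i + d j = 0 <;> simp [h]

theorem capable_of (F : Type u) [Field F] (L : Type v) [AddCommGroup L] [Module F L]
    [LieSuper F L] (habel : ∀ x y : L, sbr F x y = 0) {ι : Type} (d : ι → ZMod 2)
    (B : Basis ι F L)
    (hB : ∀ a : ZMod 2, ∀ x ∈ grd F L a, ∀ i, d i ≠ a → B.repr x i = 0)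
    (hnd : ∀ k, (∃ j, j ≠ k) ∨ (1 : F) - sg F (d k) (d k) ≠ 0) : Capable F L := by
  classical
  have hcL : IsCompl (grd F L 0) (grd F L 1) := LieSuper.isCompl_gr
  have hcT := matGr_isCompl F d
  let b : L → L → ι → ι → F := fun x y => matBr F d (B.repr x) (B.repr y)
  have b0l : ∀ y, b 0 y = 0 := by intro y; ext i j; simp [b, matBr]
  have b0r : ∀ y, b y 0 = 0 := by intro y; ext i j; simp [b, matBr]
  let inst : LieSuper F (L × (ι → ι → F)) :=
    { gr := fun a => (grd F L a).prod (matGr F d a)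
      isCompl_gr := by
        constructor
        · rw [Submodule.disjoint_def]
          rintro ⟨x, t⟩ h h'
          rw [Submodule.mem_prod] at h h'
          exact Prod.ext (Submodule.disjoint_def.mp hcL.disjoint _ h.1 h'.1)
            (Submodule.disjoint_def.mp hcT.disjoint _ h.2 h'.2)
        · rw [codisjoint_iff, eq_top_iff, Submodule.prod_sup_prod, hcL.codisjoint.eq_top,
            hcT.codisjoint.eq_top, Submodule.prod_top]
      br := fun x y => (0, b x.1 y.1)
      br_add_left := by
        intro x y z
        refine Prod.ext (by simp) ?_
        ext i j; simp [b, matBr]; ring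
      br_add_right := by
        intro x y z
        refine Prod.ext (by simp) ?_
        ext i j; simp [b, matBr]; ring
      br_smul_left := by
        intro c x y
        refine Prod.ext (by simp) ?_
        ext i j; simp [b, matBr]; ring
      br_smul_right := by
        intro c x y
        refine Prod.ext (by simp) ?_
        ext i j; simp [b, matBr]; ring
      br_gr := by
        intro a a' x hx y hy
        rw [Submodule.mem_prod] at hx hy ⊢
        refine ⟨zero_mem _, ?_⟩
        intro i j hij
        have h1 : B.repr x.1 i * B.repr y.1 j = 0 := by
          by_cases hi : d i = a
          · rw [hB a' y.1 hy.1 j (by rintro rfl; exact hij (by rw [hi])), mul_zero]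
          · rw [hB a x.1 hx.1 i hi, zero_mul]
        have h2 : B.repr y.1 i * B.repr x.1 j = 0 := by
          by_cases hi : d i = a'
          · rw [hB a x.1 hx.1 j (by rintro rfl; exact hij (by rw [hi, add_comm])), mul_zero]
          · rw [hB a' y.1 hy.1 i hi, zero_mul]
        simp [b, matBr, h1, h2]
      br_skew := by
        intro a a' x hx y hy
        rw [Submodule.mem_prod] at hx hy
        refine Prod.ext (by simp) ?_
        ext i j
        have h1 : sg F (d i) (d j) * (B.repr x.1 i * B.repr y.1 j)
            = sg F a a' * (B.repr x.1 i * B.repr y.1 j) := by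
          by_cases hi : d i = a
          · by_cases hj : d j = a'
            · rw [hi, hj]
            · rw [hB a' y.1 hy.1 j hj]; simp
          · rw [hB a x.1 hx.1 i hi]; simp
        have h2 : sg F (d i) (d j) * (B.repr y.1 i * B.repr x.1 j)
            = sg F a a' * (B.repr y.1 i * B.repr x.1 j) := by
          by_cases hi : d i = a'
          · by_cases hj : d j = a
            · rw [hi, hj, sg_comm]
            · rw [hB a x.1 hx.1 j hj]; simp
          · rw [hB a' y.1 hy.1 i hi]; simp
        have h3 := sg_mul_self F a a'
        simp only [b, matBr, Prod.smul_snd, Pi.smul_apply, smul_eq_mul]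
        rw [h1, h2]
        linear_combination (-(B.repr x.1 i * B.repr y.1 j)) * h3
      br_jacobi := by
        intro a b' c x hx y hy z hz
        simp [b0r] }
  let e : LieSupAlg.{u, max u v} F := ⟨L × (ι → ι → F)⟩
  refine ⟨e, LinearMap.fst F L (ι → ι → F), ⟨?_, ?_⟩, ?_, ?_⟩
  · intro a x hx
    exact (Submodule.mem_prod.mp hx).1
  · intro x y
    rw [habel]; rfl
  · intro x; exact ⟨(x, 0), rfl⟩
  · ext ⟨x, t⟩
    constructor
    · intro h
      have hx : x = 0 := h
      subst hx
      intro y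
      exact Prod.ext rfl (b0l _)
    · intro h
      show x = 0
      apply B.repr.injective
      ext k
      have key : ∀ j, b x (B j) k j = 0 := fun j =>
        congrFun (congrFun (congrArg Prod.snd (h (B j, 0))) k) j
      rw [map_zero, Finsupp.zero_apply]
      rcases hnd k with ⟨j, hj⟩ | hk
      · have := key j
        simpa [b, matBr, Finsupp.single_apply, hj] using this
      · have := key k
        simp only [b, matBr, Basis.repr_self, Finsupp.single_eq_same, mul_one, one_mul] at this
        have h' : ((1 : F) - sg F (d k) (d k)) * B.repr x k = 0 := by
          linear_combination this
        exact (mul_eq_zero.mp h').resolve_left hk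

/-- for `m + n ≥ 1`, the abelian Lie superalgebra `A(m | n)` is
capable if and only if `(m = 0 ∧ n = 1)` or `m + n ≥ 2`.  In particular,
`A(1 | 0)` is not capable. -/
theorem abelian_capable_iff (F : Type u) [Field F]
    (hchar2 : (2 : F) ≠ 0) (hchar3 : (3 : F) ≠ 0) :
    (∀ (m n : ℕ), 1 ≤ m + n → ∀ (L : LieSupAlg.{u, v} F),
      IsAbelSuper F m n L.carrier →
      (Capable F L.carrier ↔ ((m = 0 ∧ n = 1) ∨ 2 ≤ m + n))) ∧
    (∀ (L : LieSupAlg.{u, v} F), IsAbelSuper F 1 0 L.carrier →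
      ¬ Capable F L.carrier) := by
  refine ⟨?_, fun L hL => notCapable_one_zero F hchar2 L hL⟩
  intro m n hmn L hL
  constructor
  · intro hcap
    by_contra hcon
    have : m = 1 ∧ n = 0 := by omega
    obtain ⟨rfl, rfl⟩ := this
    exact notCapable_one_zero F hchar2 L hL hcap
  · intro hcase
    obtain ⟨habel, hfin, hm, hn⟩ := hL
    obtain ⟨B, hB⟩ := exists_homog_basis F L.carrier
    refine capable_of F L.carrier habel _ B hB ?_
    intro k
    rcases hcase with ⟨h0, h1⟩ | h2
    · right
      rcases k with k | k
      · exact absurd k.2 (by omega)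
      · have : (1 : F) - sg F 1 1 = 2 := by
          simp [sg, ZMod.val_one]; norm_num
        simpa [this] using hchar2
    · left
      have : Nontrivial (Fin (finrank F (grd F L.carrier 0)) ⊕
          Fin (finrank F (grd F L.carrier 1))) := by
        rw [← Fintype.one_lt_card_iff_nontrivial]
        simp only [Fintype.card_sum, Fintype.card_fin]
        omega
      exact exists_ne k

end SuperLie
end
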